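/- Let C₁, C₂, C₃ be real 2×2 matrices each of rank one, X_ε = ε₁C₁ + ε₂C₂ + ε₃C₃, and suppose a = det(C₁+C₂), b = det(C₁+C₃), c = det(C₂+C₃) satisfy a, b, c > 0 and b > a + c. Then there exist α, β > 0 with α + β = 1/4 and β/α = 2a/c + (b+c−a)/a > 4, such that every rank-one convex function f : M₂(ℝ) → ℝ satisfies f(0) ≤ α·(f(X₊₊₊) + f(X₊₋₋) + f(X₋₊₋) + f(X₋₋₊)) + β·(f(X₋₋₋) + f(X₊₊₋) + f(X₊₋₊) + f(X₋₊₊)). -/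

import Mathlib

open Matrix

def NullConvex (a b c : ℝ) (g : ℝ → ℝ → ℝ → ℝ) : Prop :=
  ∀ p1 p2 p3 q1 q2 q3 m1 m2 m3 t : ℝ, 0 ≤ t → t ≤ 1 →
    a * (q1 - p1) * (q2 - p2) + b * (q1 - p1) * (q3 - p3) + c * (q2 - p2) * (q3 - p3) = 0 →
    m1 = (1 - t) * p1 + t * q1 → m2 = (1 - t) * p2 + t * q2 → m3 = (1 - t) * p3 + t * q3 →
    g m1 m2 m3 ≤ (1 - t) * g p1 p2 p3 + t * g q1 q2 q3

lemma NullConvex.swap {a b c : ℝ} {g : ℝ → ℝ → ℝ → ℝ} (h : NullConvex a b c g) :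
    NullConvex c b a (fun x y z => g z y x) := by
  intro p1 p2 p3 q1 q2 q3 m1 m2 m3 t h0 h1 hq e1 e2 e3
  exact h p3 p2 p1 q3 q2 q1 m3 m2 m1 t h0 h1 (by linarith) e3 e2 e1

lemma lam_unif {a b c : ℝ} {g : ℝ → ℝ → ℝ → ℝ} (h : NullConvex a b c g) :
    8 * g 0 0 0 ≤ (g 1 1 1 + g 1 (-1) (-1) + g (-1) 1 (-1) + g (-1) (-1) 1)
      + (g (-1) (-1) (-1) + g 1 1 (-1) + g 1 (-1) 1 + g (-1) 1 1) := by
  have X : ∀ y z, g 0 y z ≤ (1 - 1/2) * g 1 y z + 1/2 * g (-1) y z := fun y z =>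
    h _ _ _ _ _ _ _ _ _ _ (by norm_num) (by norm_num) (by ring) (by ring) (by ring) (by ring)
  have Y : ∀ x z, g x 0 z ≤ (1 - 1/2) * g x 1 z + 1/2 * g x (-1) z := fun y z =>
    h _ _ _ _ _ _ _ _ _ _ (by norm_num) (by norm_num) (by ring) (by ring) (by ring) (by ring)
  have Z : ∀ x y, g x y 0 ≤ (1 - 1/2) * g x y 1 + 1/2 * g x y (-1) := fun y z =>
    h _ _ _ _ _ _ _ _ _ _ (by norm_num) (by norm_num) (by ring) (by ring) (by ring) (by ring)
  linarith [X 0 0, Y 1 0, Y (-1) 0, Z 1 1, Z 1 (-1), Z (-1) 1, Z (-1) (-1)]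

lemma lam_F {a b c : ℝ} {g : ℝ → ℝ → ℝ → ℝ} (ha : 0 < a) (hc : 0 < c) (hb : a + c < b)
    (h : NullConvex a b c g) (θ φ : ℝ) (hθ : θ = a / (b + c)) (hφ : φ = a / (b - c)) :
    ((1 - φ) + (1 - θ)) * g 0 0 0 ≤
      (1 - φ) / 2 * (g 1 1 (-1) + (1 - θ) * g (-1) (-1) (-1) + θ * g (-1) (-1) 1)
      + (1 - θ) / 2 * (g 1 (-1) 1 + (1 - φ) * g (-1) 1 1 + φ * g (-1) 1 (-1)) := by
  have hbc : 0 < b + c := by linarith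
  have hbc' : 0 < b - c := by linarith
  have t0 : 0 < θ := by rw [hθ]; positivity
  have t1 : θ < 1 := by rw [hθ, div_lt_one hbc]; linarith
  have p0 : 0 < φ := by rw [hφ]; positivity
  have p1 : φ < 1 := by rw [hφ, div_lt_one hbc']; linarith
  have et : (b + c) * θ = a := by rw [hθ]; field_simp
  have ep : (b - c) * φ = a := by rw [hφ]; field_simp
  have hS : 0 < (1 - φ) + (1 - θ) := by linarith
  have s1 := h 0 0 (-(1 - θ)) 0 0 (1 - φ) 0 0 0 ((1 - θ) / ((1 - φ) + (1 - θ)))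
    (by apply div_nonneg <;> linarith) (by rw [div_le_one hS]; linarith) (by ring) (by ring)
    (by ring) (by field_simp; ring)
  have s2 := h 1 1 (-1) (-1) (-1) (-1 + 2 * θ) 0 0 (-(1 - θ)) (1 / 2) (by norm_num)
    (by norm_num) (by linear_combination (-4) * et) (by ring) (by ring) (by ring)
  have s3 := h (-1) (-1) (-1) (-1) (-1) 1 (-1) (-1) (-1 + 2 * θ) θ t0.le t1.le (by ring)
    (by ring) (by ring) (by ring)
  have s4 := h 1 (-1) 1 (-1) 1 (1 - 2 * φ) 0 0 (1 - φ) (1 / 2) (by norm_num)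
    (by norm_num) (by linear_combination 4 * ep) (by ring) (by ring) (by ring)
  have s5 := h (-1) 1 1 (-1) 1 (-1) (-1) 1 (1 - 2 * φ) φ p0.le p1.le (by ring)
    (by ring) (by ring) (by ring)
  have s1' := mul_le_mul_of_nonneg_left s1 hS.le
  have e1 : ((1 - φ) + (1 - θ)) * ((1 - (1 - θ) / ((1 - φ) + (1 - θ))) * g 0 0 (-(1 - θ)) +
      (1 - θ) / ((1 - φ) + (1 - θ)) * g 0 0 (1 - φ))
      = (1 - φ) * g 0 0 (-(1 - θ)) + (1 - θ) * g 0 0 (1 - φ) := by field_simp; ring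
  rw [e1] at s1'
  have A : g 0 0 (-(1 - θ)) ≤
      1 / 2 * (g 1 1 (-1) + (1 - θ) * g (-1) (-1) (-1) + θ * g (-1) (-1) 1) := by linarith
  have B : g 0 0 (1 - φ) ≤
      1 / 2 * (g 1 (-1) 1 + (1 - φ) * g (-1) 1 1 + φ * g (-1) 1 (-1)) := by linarith
  have A' := mul_le_mul_of_nonneg_left A (by linarith : 0 ≤ 1 - φ)
  have B' := mul_le_mul_of_nonneg_left B (by linarith : 0 ≤ 1 - θ)
  linarith

set_option maxHeartbeats 4000000 in
lemma lam_H {a b c : ℝ} {g : ℝ → ℝ → ℝ → ℝ} (ha : 0 < a) (hc : 0 < c) (hb : a + c < b)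
    (h : NullConvex a b c g) (θ : ℝ) (hθ : θ = a / (b + c)) :
    4 * g 0 0 0 ≤ θ * (1 - θ) * g 1 1 1 + θ * (1 + θ) * g (-1) (-1) 1
      + (1 - θ) * (1 + θ) * g (-1) (-1) (-1) + (1 - θ) * g 1 (-1) 1 + (1 - θ) * g (-1) 1 1
      + (1 + θ ^ 2) * g 1 1 (-1) := by
  have hbc : 0 < b + c := by linarith
  have hbc' : 0 < b - c := by linarith
  have hbca : 0 < b + c - a := by linarith
  have b0 : 0 < b := by linarith
  have t0 : 0 < θ := by rw [hθ]; positivity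
  have t1 : θ < 1 := by rw [hθ, div_lt_one hbc]; linarith
  have et : (b + c) * θ = a := by rw [hθ]; field_simp
  obtain ⟨D, hD⟩ : ∃ D, D = (b + c) ^ 2 - a * c := ⟨_, rfl⟩
  obtain ⟨L, hL⟩ : ∃ L, L = 2 * b + 2 * c - a := ⟨_, rfl⟩
  obtain ⟨k, hk⟩ : ∃ k, k = b ^ 2 - c ^ 2 + a * c := ⟨_, rfl⟩
  obtain ⟨N, hN⟩ : ∃ N, N = (b + c) * (b + c - a) * (b - c) := ⟨_, rfl⟩
  have D0 : 0 < D := by rw [hD]; nlinarith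
  have L0 : 0 < L := by linarith
  have k0 : 0 < k := by rw [hk]; nlinarith [mul_pos ha hc, mul_pos hbc hbc']
  have N0 : 0 < N := by rw [hN]; positivity
  have hLk : L * k = a * D + 2 * N := by rw [hL, hk, hD, hN]; ring
  have M0 : 0 < N + a * D := by positivity
  have hkle : k ≤ 2 * (b ^ 2 - c ^ 2) := by
    rw [hk]; nlinarith [mul_pos ha hc, mul_pos hbc (by linarith : 0 < b - c - a)]
  have hB : 0 < b ^ 2 - c ^ 2 := by nlinarith
  -- null segments through the points S3(s)
  have S : ∀ s z, -1 ≤ s → s ≤ 1 → z = -(1 - θ) - θ * s → g s s z ≤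
      (1 + s) / 2 * g 1 1 (-1)
        + (1 - s) / 2 * ((1 - θ) * g (-1) (-1) (-1) + θ * g (-1) (-1) 1) := by
    intro s z h1 h2 hz
    have s2 := h 1 1 (-1) (-1) (-1) (-1 + 2 * θ) s s z ((1 - s) / 2) (by linarith)
      (by linarith) (by linear_combination (-4) * et) (by ring) (by ring) (by rw [hz]; ring)
    have s3 := h (-1) (-1) (-1) (-1) (-1) 1 (-1) (-1) (-1 + 2 * θ) θ t0.le t1.le (by ring)
      (by ring) (by ring) (by ring)
    have s3' := mul_le_mul_of_nonneg_left s3 (by linarith : 0 ≤ (1 - s) / 2)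
    linarith
  obtain ⟨u, hu⟩ : ∃ u, u = -a / L := ⟨_, rfl⟩
  obtain ⟨s, hs⟩ : ∃ s, s = -(b ^ 2 - c ^ 2 + a * c) / D := ⟨_, rfl⟩
  obtain ⟨w, hw⟩ : ∃ w, w = -1 + 2 * a * b / D := ⟨_, rfl⟩
  obtain ⟨zR, hzR⟩ : ∃ z, z = 2 * N / (L * k) + a * D / (L * k) * w := ⟨_, rfl⟩
  have hs1 : 1 + s = 2 * c * (b + c - a) / D := by
    rw [hs]; field_simp; rw [hD]; ring
  have hs2 : 1 - s = 2 * b * (b + c) / D := by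
    rw [hs]; field_simp; rw [hD]; ring
  have hu1 : 1 + u = 2 * (b + c - a) / L := by rw [hu]; field_simp; rw [hL]; ring
  have hu2 : 1 - u = 2 * (b + c) / L := by rw [hu]; field_simp; rw [hL]; ring
  have s0 : 0 < 1 + s := by rw [hs1]; positivity
  have s0' : 0 < 1 - s := by rw [hs2]; positivity
  have u0 : 0 < 1 + u := by rw [hu1]; positivity
  have u0' : 0 < 1 - u := by rw [hu2]; positivity
  have hw1 : 1 - w = 2 * (b + c) * (b + c - a) / D := by
    rw [hw]; field_simp; rw [hD]; ring
  have hw' : w = -(1 - θ) - θ * s := by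
    have : w = -1 + θ * (1 - s) := by rw [hw, hs2, hθ]; field_simp
    linarith
  have haw : a * D * w = -(a * D) + 2 * a ^ 2 * b := by rw [hw]; field_simp
  have hzR' : zR = -(1 - θ) - θ * u + 2 * (b + c - a) * (b - c) / k := by
    have e1 : zR = (2 * N + a * D * w) / (L * k) := by rw [hzR]; field_simp
    have e2 : -(1 - θ) - θ * u = -1 + 2 * a / L := by
      have : -(1 - θ) - θ * u = -1 + θ * (1 - u) := by ring
      rw [this, hu2, hθ]; field_simp
    rw [e1, e2, haw]; field_simp; rw [hN, hD, hL, hk]; ring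
  -- step 1
  have st1 := h 1 1 (-θ) u u (-θ * u) 0 0 0 (L / (2 * (b + c))) (by positivity)
    (by rw [div_le_one (by positivity)]; linarith)
    (by linear_combination (-(u - 1) ^ 2) * et) (by rw [hu]; field_simp; rw [hL]; ring)
    (by rw [hu]; field_simp; rw [hL]; ring) (by rw [hu]; field_simp; rw [hL]; ring)
  have st2 := h 1 1 1 1 1 (-1) 1 1 (-θ) ((1 + θ) / 2) (by linarith) (by linarith) (by ring)
    (by ring) (by ring) (by ring)
  have st3 := h u u (-(1 - θ) - θ * u) u u zR u u (-θ * u) (k / (2 * (b ^ 2 - c ^ 2)))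
    (by positivity) (by rw [div_le_one (by positivity)]; exact hkle) (by ring) (by ring) (by ring)
    (by
      have e3 : 1 - θ = k / (2 * (b ^ 2 - c ^ 2)) * (2 * (b + c - a) * (b - c) / k) := by
        have : b ^ 2 - c ^ 2 = (b + c) * (b - c) := by ring
        rw [this, hθ]; field_simp
      rw [hzR']; linear_combination e3)
  -- step 4 : R between X2 and P
  obtain ⟨π, hπ⟩ : ∃ π, π = N / (N + a * D) := ⟨_, rfl⟩
  obtain ⟨l, hl⟩ : ∃ l, l = (N + a * D) / (L * k) := ⟨_, rfl⟩
  have st5 := h s s w (-1) 1 1 ((1 - π) * s + π * (-1)) ((1 - π) * s + π * 1)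
    ((1 - π) * w + π * 1) π (by rw [hπ]; positivity)
    (by rw [hπ, div_le_one M0]; nlinarith) (by
      have e : a * (-1 - s) * (1 - s) + b * (-1 - s) * (1 - w) + c * (1 - s) * (1 - w)
        = -(a * (1 + s) * (1 - s) + b * (1 + s) * (1 - w) - c * (1 - s) * (1 - w)) := by ring
      rw [e, hs1, hs2, hw1]; field_simp; ring) rfl rfl rfl
  have q1 : 1 - π = a * D / (N + a * D) := by rw [hπ]; field_simp; ring
  have q2 : 1 + π = L * k / (N + a * D) := by rw [hπ, hLk]; field_simp; ring
  have hDs : D * s = -k := by rw [hs, hk]; field_simp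
  have q3 : (1 - π) * s = -(a * k) / (N + a * D) := by
    rw [q1]; field_simp; linear_combination hDs
  have d1 : (1 - π) * s + π * (-1) - 1 = -2 * k * (b + c) / (N + a * D) := by
    have : (1 - π) * s + π * (-1) - 1 = (1 - π) * s - (1 + π) := by ring
    rw [this, q3, q2]; field_simp; rw [hL]; ring
  have d2 : (1 - π) * s + π * 1 - -1 = 2 * k * (b + c - a) / (N + a * D) := by
    have : (1 - π) * s + π * 1 - -1 = (1 - π) * s + (1 + π) := by ring
    rw [this, q3, q2]; field_simp; rw [hL]; ring
  have d3 : (1 - π) * w + π * 1 - 1 = -2 * a * (b + c) * (b + c - a) / (N + a * D) := by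
    have : (1 - π) * w + π * 1 - 1 = -((1 - π) * (1 - w)) := by ring
    rw [this, q1, hw1]; field_simp
  have l1 : l * (1 + π) = 1 := by rw [hl, q2]; field_simp
  have l2 : l * ((1 - π) * s) = u := by
    rw [hl, q3, hu]; field_simp
  have l3 : l * (1 - π) = a * D / (L * k) := by rw [hl, q1]; field_simp
  have l4 : l * π = N / (L * k) := by rw [hl, hπ]; field_simp
  have l5 : 1 - l = N / (L * k) := by linear_combination l4 - l1
  have l0 : 0 ≤ l := by rw [hl]; positivity
  have l0' : l ≤ 1 := by rw [hl, div_le_one (by positivity)]; linarith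
  have st4 := h 1 (-1) 1 ((1 - π) * s + π * (-1)) ((1 - π) * s + π * 1)
    ((1 - π) * w + π * 1) u u zR l l0 l0'
    (by rw [d1, d2, d3]; field_simp; rw [hk]; ring)
    (by linear_combination l1 - l2) (by linear_combination -l1 - l2)
    (by rw [hzR]; linear_combination -l5 - l4 - w * l3)
  have Ss := S s w (by linarith) (by linarith) hw'
  have Su := S u _ (by linarith) (by linarith) rfl
  have hR : g u u zR ≤ N / (L * k) * (g 1 (-1) 1 + g (-1) 1 1) + a * D / (L * k) * g s s w := by
    have := mul_le_mul_of_nonneg_left st5 l0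
    rw [← l3, ← l4]
    have e : (1 - l) * g 1 (-1) 1 = l * π * g 1 (-1) 1 := by rw [l5, l4]
    linarith
  clear st5 st4
  obtain ⟨ν, hν⟩ : ∃ ν, ν = L / (2 * (b + c)) := ⟨_, rfl⟩
  obtain ⟨μ, hμ⟩ : ∃ μ, μ = k / (2 * (b ^ 2 - c ^ 2)) := ⟨_, rfl⟩
  rw [← hν] at st1
  rw [← hμ] at st3
  have ν0 : 0 ≤ ν := by rw [hν]; positivity
  have μ0 : 0 ≤ μ := by rw [hμ]; positivity
  have μ1 : 0 ≤ 1 - μ := by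
    rw [hμ, sub_nonneg, div_le_one (by positivity)]; exact hkle
  have hB' : b ^ 2 - c ^ 2 = (b + c) * (b - c) := by ring
  have c1 : 4 * (1 - ν) = 2 * θ := by rw [hν, hθ]; field_simp; rw [hL]; ring
  have c2 : 4 * ν * μ * (N / (L * k)) = 1 - θ := by
    rw [hν, hμ, hθ, hN, hB']; field_simp; ring
  have c3 : 4 * ν * μ * (a * D / (L * k)) * ((1 - s) / 2)
      + 4 * ν * (1 - μ) * ((1 - u) / 2) = 1 + θ := by
    rw [hs2, hu2, hν, hμ, hθ, hB']; field_simp; rw [hk]; ring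
  have c4 : 4 * ν * μ * (a * D / (L * k)) * ((1 + s) / 2)
      + 4 * ν * (1 - μ) * ((1 + u) / 2) = 1 - θ := by
    have e : 4 * ν * μ * (a * D / (L * k)) + 4 * ν * (1 - μ) = 2 := by
      have : a * D / (L * k) = 1 - 2 * (N / (L * k)) := by
        field_simp; linarith
      rw [this]; linear_combination (-2) * c2 - c1
    linear_combination e - c3
  have κ0 : 0 ≤ 4 * ν * μ * (a * D / (L * k)) := by positivity
  have m2 := mul_le_mul_of_nonneg_left st2 (by linarith : 0 ≤ 2 * θ)
  have m3 := mul_le_mul_of_nonneg_left st3 (by linarith : 0 ≤ 4 * ν)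
  have mR := mul_le_mul_of_nonneg_left hR (by positivity : 0 ≤ 4 * ν * μ)
  have mS := mul_le_mul_of_nonneg_left Ss κ0
  have mU := mul_le_mul_of_nonneg_left Su (by positivity : 0 ≤ 4 * ν * (1 - μ))
  generalize a * D / (L * k) = κ at *
  generalize N / (L * k) = η at *
  generalize g u u zR = gR at *
  generalize g s s w = gS at *
  generalize g u u (-(1 - θ) - θ * u) = gSu at *
  generalize g u u (-θ * u) = gU at *
  generalize g 1 1 (-θ) = gK at *
  generalize g 1 1 1 = v1 at *
  generalize g 1 1 (-1) = v2 at *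
  generalize g 1 (-1) 1 = v3 at *
  generalize g (-1) 1 1 = v4 at *
  generalize g (-1) (-1) 1 = v5 at *
  generalize g (-1) (-1) (-1) = v6 at *
  generalize g 0 0 0 = v0 at *
  have z1 : 4 * (1 - ν) * gK = 2 * θ * gK := by rw [c1]
  have z2 : 4 * ν * μ * η * (v3 + v4) = (1 - θ) * (v3 + v4) := by rw [c2]
  have z3 := congrArg (fun x => x * ((1 - θ) * v6 + θ * v5)) c3
  have z4 := congrArg (fun x => x * v2) c4
  beta_reduce at z3 z4
  clear hR Ss Su st2 st3 S h
  linarith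

set_option maxHeartbeats 4000000 in
lemma lam_new {a b c : ℝ} {g : ℝ → ℝ → ℝ → ℝ} (ha : 0 < a) (hc : 0 < c) (hb : a + c < b)
    (h : NullConvex a b c g) (r : ℝ) (hr : r = (b + c - a) / a + (a + b - c) / c) :
    4 * (1 + r) * g 0 0 0 ≤
      (g 1 1 1 + g 1 (-1) (-1) + g (-1) 1 (-1) + g (-1) (-1) 1)
      + r * (g (-1) (-1) (-1) + g 1 1 (-1) + g 1 (-1) 1 + g (-1) 1 1) := by
  have hbc : 0 < b + c := by linarith
  have hba : 0 < b + a := by linarith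
  have hbc' : 0 < b - c := by linarith
  have hbca : 0 < b + c - a := by linarith
  have hS : 0 < a + b + c := by linarith
  have H := lam_H ha hc hb h _ rfl
  have H' := lam_H hc ha (by linarith) h.swap _ rfl
  have F := lam_F ha hc hb h _ _ rfl rfl
  beta_reduce at H'
  have mH := mul_le_mul_of_nonneg_left H
    (by positivity : 0 ≤ 2 * c * (b + c) ^ 2 / ((b + c - a) * a * (a + b + c)))
  have mH' := mul_le_mul_of_nonneg_left H'
    (by positivity : 0 ≤ (b + a) ^ 2 / (c * (a + b + c)))
  have mF := mul_le_mul_of_nonneg_left F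
    (by positivity : 0 ≤ 2 * (b + c) * (b - c) / ((b + c - a) * a))
  clear H H' F h
  generalize g 0 0 0 = v0 at *
  generalize g 1 1 1 = v1 at *
  generalize g 1 1 (-1) = v2 at *
  generalize g 1 (-1) 1 = v3 at *
  generalize g (-1) 1 1 = v4 at *
  generalize g (-1) (-1) 1 = v5 at *
  generalize g (-1) (-1) (-1) = v6 at *
  generalize g 1 (-1) (-1) = v7 at *
  generalize g (-1) 1 (-1) = v8 at *
  have key := add_le_add (add_le_add mH mH') mF
  refine le_of_eq_of_le ?_ (le_of_le_of_eq key ?_)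
  · rw [hr]; field_simp; ring
  · rw [hr]; field_simp; ring

lemma det_eq_zero_of_rank_one (C : Matrix (Fin 2) (Fin 2) ℝ) (h : C.rank = 1) : C.det = 0 := by
  by_contra hd
  have := Matrix.rank_of_isUnit C ((Matrix.isUnit_iff_isUnit_det C).2 (isUnit_iff_ne_zero.2 hd))
  rw [h] at this
  simp at this

lemma rank_le_one_of_det (B : Matrix (Fin 2) (Fin 2) ℝ) (h : B.det = 0) : B.rank ≤ 1 := by
  rw [Matrix.det_fin_two] at h
  by_cases h0 : B 0 0 = 0
  · by_cases h1 : B 0 1 = 0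
    · have : B = Matrix.vecMulVec ![0, 1] ![B 1 0, B 1 1] := by
        ext i j; fin_cases i <;> fin_cases j <;> simp [Matrix.vecMulVec, h0, h1]
      rw [this]; exact Matrix.rank_vecMulVec_le _ _
    · have h2 : B 1 0 = 0 := by
        rw [h0] at h
        have : B 0 1 * B 1 0 = 0 := by linarith
        exact (mul_eq_zero.1 this).resolve_left h1
      have : B = Matrix.vecMulVec ![B 0 1, B 1 1] ![0, 1] := by
        ext i j; fin_cases i <;> fin_cases j <;> simp [Matrix.vecMulVec, h0, h2]
      rw [this]; exact Matrix.rank_vecMulVec_le _ _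
  · have : B = Matrix.vecMulVec ![1, B 1 0 / B 0 0] ![B 0 0, B 0 1] := by
      ext i j; fin_cases i <;> fin_cases j <;> simp [Matrix.vecMulVec, h0]
      field_simp; linarith
    rw [this]; exact Matrix.rank_vecMulVec_le _ _

lemma det_comb (C₁ C₂ C₃ : Matrix (Fin 2) (Fin 2) ℝ)
    (h1 : C₁.det = 0) (h2 : C₂.det = 0) (h3 : C₃.det = 0) (x y z : ℝ) :
    (x • C₁ + y • C₂ + z • C₃).det = (C₁ + C₂).det * x * y + (C₁ + C₃).det * x * z
      + (C₂ + C₃).det * y * z := by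
  simp only [Matrix.det_fin_two, Matrix.add_apply, Matrix.smul_apply, smul_eq_mul] at *
  linear_combination (x ^ 2 - x * y - x * z) * h1 + (y ^ 2 - x * y - y * z) * h2
    + (z ^ 2 - x * z - y * z) * h3

lemma nullConvex_of (C₁ C₂ C₃ : Matrix (Fin 2) (Fin 2) ℝ)
    (h1 : C₁.det = 0) (h2 : C₂.det = 0) (h3 : C₃.det = 0)
    (f : Matrix (Fin 2) (Fin 2) ℝ → ℝ)
    (hf : ∀ A B : Matrix (Fin 2) (Fin 2) ℝ, B.rank ≤ 1 →
          ConvexOn ℝ Set.univ (fun t : ℝ => f (A + t • B))) :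
    NullConvex (C₁ + C₂).det (C₁ + C₃).det (C₂ + C₃).det
      (fun x y z => f (x • C₁ + y • C₂ + z • C₃)) := by
  intro p1 p2 p3 q1 q2 q3 m1 m2 m3 t t0 t1 hq e1 e2 e3
  have hr := rank_le_one_of_det ((q1 - p1) • C₁ + (q2 - p2) • C₂ + (q3 - p3) • C₃)
    (by rw [det_comb C₁ C₂ C₃ h1 h2 h3]; exact hq)
  have hc := (hf (p1 • C₁ + p2 • C₂ + p3 • C₃) _ hr).2 (Set.mem_univ 0) (Set.mem_univ 1)
    (by linarith : 0 ≤ 1 - t) t0 (by ring)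
  simp only [smul_eq_mul, mul_zero, mul_one, zero_add, zero_smul, add_zero, one_smul] at hc
  have k1 : p1 • C₁ + p2 • C₂ + p3 • C₃ + t • ((q1 - p1) • C₁ + (q2 - p2) • C₂ + (q3 - p3) • C₃)
      = m1 • C₁ + m2 • C₂ + m3 • C₃ := by rw [e1, e2, e3]; module
  have k2 : p1 • C₁ + p2 • C₂ + p3 • C₃ + ((q1 - p1) • C₁ + (q2 - p2) • C₂ + (q3 - p3) • C₃)
      = q1 • C₁ + q2 • C₂ + q3 • C₃ := by module
  rw [k1, k2] at hc
  exact hc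

/-- Case 2 of the main theorem. If `b > a + c` then there is a symmetric
laminate with ratio `β/α = 2a/c + (b+c−a)/a > 4`. -/
theorem symmetric_laminate_case_two
    (C₁ C₂ C₃ : Matrix (Fin 2) (Fin 2) ℝ)
    (hC₁ : C₁.rank = 1) (hC₂ : C₂.rank = 1) (hC₃ : C₃.rank = 1)
    (ha : 0 < (C₁ + C₂).det) (hb : 0 < (C₁ + C₃).det) (hc : 0 < (C₂ + C₃).det)
    (hbig : (C₁ + C₂).det + (C₂ + C₃).det < (C₁ + C₃).det) :
    ∃ α β : ℝ, 0 < α ∧ 0 < β ∧ α + β = 1/4 ∧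
      β / α = 2 * (C₁ + C₂).det / (C₂ + C₃).det
                + ((C₁ + C₃).det + (C₂ + C₃).det - (C₁ + C₂).det) / (C₁ + C₂).det ∧
      4 < β / α ∧
      ∀ f : Matrix (Fin 2) (Fin 2) ℝ → ℝ,
        (∀ A B : Matrix (Fin 2) (Fin 2) ℝ, B.rank ≤ 1 →
          ConvexOn ℝ Set.univ (fun t : ℝ => f (A + t • B))) →
        f 0 ≤ α * (f (C₁ + C₂ + C₃) + f (C₁ - C₂ - C₃) + f (-C₁ + C₂ - C₃)
                     + f (-C₁ - C₂ + C₃))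
            + β * (f (-C₁ - C₂ - C₃) + f (C₁ + C₂ - C₃) + f (C₁ - C₂ + C₃)
                     + f (-C₁ + C₂ + C₃)) := by
  have d1 := det_eq_zero_of_rank_one C₁ hC₁
  have d2 := det_eq_zero_of_rank_one C₂ hC₂
  have d3 := det_eq_zero_of_rank_one C₃ hC₃
  have hN := nullConvex_of C₁ C₂ C₃ d1 d2 d3
  generalize (C₁ + C₂).det = a at *
  generalize (C₁ + C₃).det = b at *
  generalize (C₂ + C₃).det = c at *
  obtain ⟨r, hr⟩ : ∃ r, r = 2 * a / c + (b + c - a) / a := ⟨_, rfl⟩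
  obtain ⟨r', hr'⟩ : ∃ r', r' = (b + c - a) / a + (a + b - c) / c := ⟨_, rfl⟩
  have r4 : 4 < r := by
    have e : r - 4 = (b - a - c) / a + 2 * (a - c) ^ 2 / (a * c) := by
      rw [hr]; field_simp; ring
    have : 0 < (b - a - c) / a := div_pos (by linarith) ha
    have : 0 ≤ 2 * (a - c) ^ 2 / (a * c) := by positivity
    linarith
  have rr : r ≤ r' := by
    have e : r' - r = (b - a - c) / c := by rw [hr, hr']; field_simp; ring
    have : 0 < (b - a - c) / c := div_pos (by linarith) hc
    linarith
  have hdiv : r / (4 * (1 + r)) / (1 / (4 * (1 + r))) = r := by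
    have : 0 < 1 + r := by linarith
    field_simp
  have hpos : 0 < 1 + r := by linarith
  have hpos' : 0 < r := by linarith
  refine ⟨1 / (4 * (1 + r)), r / (4 * (1 + r)), by positivity, by positivity,
    by field_simp, by rw [hdiv, hr], by rw [hdiv]; exact r4, ?_⟩
  intro f hf
  have U := lam_unif (hN f hf)
  have V := lam_new ha hc hbig (hN f hf) r' hr'
  simp only [zero_smul, one_smul, neg_smul, add_zero, ← sub_eq_add_neg] at U V
  generalize f (C₁ + C₂ + C₃) + f (C₁ - C₂ - C₃) + f (-C₁ + C₂ - C₃)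
                     + f (-C₁ - C₂ + C₃) = A at *
  generalize f (-C₁ - C₂ - C₃) + f (C₁ + C₂ - C₃) + f (C₁ - C₂ + C₃)
                     + f (-C₁ + C₂ + C₃) = B at *
  have hp : 0 < r' - 1 := by linarith
  have U' := mul_le_mul_of_nonneg_left U (by linarith : 0 ≤ r' - r)
  have V' := mul_le_mul_of_nonneg_left V (by linarith : 0 ≤ r - 1)
  have W : (r' - 1) * (4 * (1 + r) * f 0) ≤ (r' - 1) * (A + r * B) := by linarith
  have W' := le_of_mul_le_mul_left W hp
  have e : 1 / (4 * (1 + r)) * A + r / (4 * (1 + r)) * B = (A + r * B) / (4 * (1 + r)) := by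
    ring
  rw [e, le_div_iff₀ (by positivity)]
  linarith
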